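/- Let u ∈ ℤ_p^× with −u ∉ Nm_{H/ℚ_p}(H^×). If x, z ∈ H satisfy x·x̄ + u·z·z̄ = 1, then x ∈ O_H and z ∈ O_H. -/

import Mathlib

/- Common setup: ramified quadratic extension H/ℚ_p, ring of integers O_H,
   hermitian forms, lattices, duals, vertex lattices. -/

open scoped Classical

noncomputable section

namespace Ramified

/-- The ring of integers of `H`: the integral closure of `ℤ_p` in `H`. -/
def OH (p : ℕ) [Fact (Nat.Prime p)] (H : Type) [Field H] [Algebra ℚ_[p] H] : Subring H :=
  letI : Algebra ℤ_[p] H := ((algebraMap ℚ_[p] H).comp PadicInt.Coe.ringHom).toAlgebra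
  (integralClosure ℤ_[p] H).toSubring

/-- `H/ℚ_p` is a ramified quadratic extension with nontrivial Galois automorphism `conj`
and uniformizer `ϖ` satisfying `conj ϖ = -ϖ` and `ϖ² = π₀` a uniformizer of `ℤ_p`. -/
structure IsRamifiedQuadratic (p : ℕ) [Fact (Nat.Prime p)] (H : Type) [Field H]
    [Algebra ℚ_[p] H] (conj : H ≃+* H) (ϖ : H) : Prop where
  conj_conj : ∀ x : H, conj (conj x) = x
  conj_fix : ∀ q : ℚ_[p], conj (algebraMap ℚ_[p] H q) = algebraMap ℚ_[p] H q
  conj_ne : conj ≠ RingEquiv.refl H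
  dim_two : Module.finrank ℚ_[p] H = 2
  conj_unif : conj ϖ = -ϖ
  unif_sq : ∃ u : ℤ_[p]ˣ, ϖ * ϖ = algebraMap ℚ_[p] H ((u : ℤ_[p]) : ℚ_[p]) * (p : H)

variable {p : ℕ} [Fact (Nat.Prime p)] {H : Type} [Field H] [Algebra ℚ_[p] H]

/-- Any `H`-module is an `O_H`-module by restriction of scalars. -/
instance moduleOH (C : Type) [AddCommGroup C] [Module H C] : Module (OH p H) C :=
  Module.compHom C (OH p H).subtype

variable {C : Type} [AddCommGroup C] [Module H C]

theorem oh_smul_def (c : OH p H) (x : C) : c • x = (c : H) • x := rfl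

/-- A hermitian form on `C` with respect to the conjugation `conj` of `H`:
linear in the first variable, conjugate-symmetric. -/
structure HermForm (H : Type) [Field H] (C : Type) [AddCommGroup C] [Module H C]
    (conj : H ≃+* H) where
  form : C → C → H
  form_add : ∀ x y z : C, form (x + y) z = form x z + form y z
  form_smul : ∀ (a : H) (x y : C), form (a • x) y = a * form x y
  form_conj : ∀ x y : C, form y x = conj (form x y)

variable {conj : H ≃+* H}

theorem HermForm.form_zero (φ : HermForm H C conj) (y : C) : φ.form 0 y = 0 := by
  have h := φ.form_smul (0 : H) 0 y
  simpa using h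

/-- The dual lattice `Λ♯ = {x : C | φ(x, Λ) ⊆ O_H}`. -/
def HermForm.dual (φ : HermForm H C conj) (Λ : Submodule (OH p H) C) :
    Submodule (OH p H) C where
  carrier := {x : C | ∀ y ∈ Λ, φ.form x y ∈ OH p H}
  add_mem' := by
    intro a b ha hb y hy
    rw [φ.form_add]
    exact add_mem (ha y hy) (hb y hy)
  zero_mem' := by
    intro y hy
    rw [HermForm.form_zero]
    exact zero_mem _
  smul_mem' := by
    intro c x hx y hy
    show φ.form ((c : H) • x) y ∈ OH p H
    rw [φ.form_smul]
    exact mul_mem c.2 (hx y hy)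

/-- The orthogonal complement (in `C = L ⊗ H`) of a sublattice. -/
def HermForm.orthog (φ : HermForm H C conj) (N : Submodule (OH p H) C) :
    Submodule (OH p H) C where
  carrier := {x : C | ∀ y ∈ N, φ.form x y = 0}
  add_mem' := by
    intro a b ha hb y hy
    rw [φ.form_add, ha y hy, hb y hy, add_zero]
  zero_mem' := by
    intro y hy
    rw [HermForm.form_zero]
  smul_mem' := by
    intro c x hx y hy
    show φ.form ((c : H) • x) y = 0
    rw [φ.form_smul, hx y hy, mul_zero]

/-- Scalar multiplication by `a : H`, as an `O_H`-linear map. -/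
def smulMap (a : H) : C →ₗ[OH p H] C where
  toFun x := a • x
  map_add' x y := smul_add a x y
  map_smul' c x := by
    show a • ((c : H) • x) = (c : H) • (a • x)
    rw [smul_comm]

/-- The lattice `a • Λ` for a scalar `a : H`. -/
def scale (a : H) (Λ : Submodule (OH p H) C) : Submodule (OH p H) C :=
  Λ.map (smulMap a)

/-- An `H`-subspace of `C`, viewed as an `O_H`-submodule. -/
def restrictOH (W : Submodule H C) : Submodule (OH p H) C where
  carrier := (W : Set C)
  add_mem' := fun ha hb => W.add_mem ha hb
  zero_mem' := W.zero_mem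
  smul_mem' := fun c x hx => W.smul_mem (c : H) hx

/-- The cardinality of the quotient `Λ/N` (for `N ⊆ Λ` this is the usual quotient). -/
def quotCard (N Λ : Submodule (OH p H) C) : ℕ :=
  Nat.card (Λ ⧸ N.comap Λ.subtype)

/-- A (full) `O_H`-lattice in `C`: finitely generated and spanning `C` over `H`. -/
def IsLattice (Λ : Submodule (OH p H) C) : Prop :=
  Λ.FG ∧ Submodule.span H (Λ : Set C) = ⊤

/-- A vertex lattice: a full lattice with `ϖΛ ⊆ Λ♯ ⊆ Λ`. -/
def IsVertexLattice (φ : HermForm H C conj) (ϖ : H) (Λ : Submodule (OH p H) C) : Prop :=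
  IsLattice Λ ∧ scale ϖ Λ ≤ φ.dual Λ ∧ φ.dual Λ ≤ Λ

/-- `Λ ∈ Vert(L)`: a vertex lattice with `L ⊆ Λ♯`. -/
def InVert (φ : HermForm H C conj) (ϖ : H) (L Λ : Submodule (OH p H) C) : Prop :=
  IsVertexLattice φ ϖ Λ ∧ L ≤ φ.dual Λ

/-- `M` is `a`-modular (e.g. `a = ϖ^i`): `(x, M) = a·O_H` for every maximal `x ∈ M`. -/
def IsPiModular (φ : HermForm H C conj) (ϖ a : H) (M : Submodule (OH p H) C) : Prop :=
  ∀ x ∈ M, x ∉ scale ϖ M →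
    (fun y => φ.form x y) '' (M : Set C) = (fun c => a * c) '' ((OH p H : Set H))

/-- `N` is split: an orthogonal direct sum of hyperbolic planes `H(i)`. -/
def IsSplitLat (φ : HermForm H C conj) (ϖ : H) (N : Submodule (OH p H) C) : Prop :=
  ∃ (s : ℕ) (e f : Fin s → C) (d : Fin s → ℕ),
    N = Submodule.span (OH p H) (Set.range e ∪ Set.range f) ∧
    (∀ j, φ.form (e j) (e j) = 0 ∧ φ.form (f j) (f j) = 0 ∧
      φ.form (e j) (f j) = ϖ ^ d j) ∧
    ∀ j j', j ≠ j' → φ.form (e j) (e j') = 0 ∧ φ.form (e j) (f j') = 0 ∧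
      φ.form (f j) (e j') = 0 ∧ φ.form (f j) (f j') = 0

/-- The `O_H`-rank of a sublattice of `C` (the dimension of the subspace it spans). -/
def rk (N : Submodule (OH p H) C) : ℕ :=
  Module.finrank H (Submodule.span H (N : Set C))

/-- A Jordan splitting `L = ⊕_{0 ≤ λ ≤ k} L_λ` with `L_λ` being `ϖ^λ`-modular (or zero). -/
structure JordanSplitting (φ : HermForm H C conj) (ϖ : H) (L : Submodule (OH p H) C)
    (k : ℕ) (Lc : ℕ → Submodule (OH p H) C) : Prop where
  sup_eq : L = ⨆ i ∈ Finset.range (k + 1), Lc i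
  bot_of_gt : ∀ i, k < i → Lc i = ⊥
  disj : ∀ i ∈ Finset.range (k + 1),
    Disjoint (Lc i) (⨆ j ∈ (Finset.range (k + 1)).erase i, Lc j)
  orthog : ∀ i j, i ≠ j → ∀ x ∈ Lc i, ∀ y ∈ Lc j, φ.form x y = 0
  modular : ∀ i ∈ Finset.range (k + 1), Lc i ≠ ⊥ → IsPiModular φ ϖ (ϖ ^ i) (Lc i)

/-- `L_{≥ t} = ⊕_{λ ≥ t} L_λ`. -/
def Lge (Lc : ℕ → Submodule (OH p H) C) (k t : ℕ) : Submodule (OH p H) C :=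
  ⨆ i ∈ Finset.Icc t k, Lc i

/-- `m(L) = rank_{O_H} L_{≥1}`. -/
def mOf (Lc : ℕ → Submodule (OH p H) C) (k : ℕ) : ℕ :=
  ∑ i ∈ Finset.Icc 1 k, rk (Lc i)

/-- The invariant `t(L)` from Theorem A. -/
def tOf (φ : HermForm H C conj) (ϖ : H) (Lc : ℕ → Submodule (OH p H) C) (k : ℕ) : ℕ :=
  if Odd (mOf Lc k) then mOf Lc k - 1
  else if IsSplitLat φ ϖ (Lge Lc k 1) then mOf Lc k
  else mOf Lc k - 2

/-- `n_odd = Σ_{λ ≥ 3, λ odd} rank L_λ`. -/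
def nOdd (Lc : ℕ → Submodule (OH p H) C) (k : ℕ) : ℕ :=
  ∑ i ∈ (Finset.Icc 3 k).filter (fun i => Odd i), rk (Lc i)

/-- `n_even = Σ_{λ ≥ 2, λ even} rank L_λ`. -/
def nEven (Lc : ℕ → Submodule (OH p H) C) (k : ℕ) : ℕ :=
  ∑ i ∈ (Finset.Icc 2 k).filter (fun i => Even i), rk (Lc i)

end Ramified

namespace Ramified

theorem exists_sq_eq_neg_of_norm_lt_one {p : ℕ} [Fact (Nat.Prime p)] (hp : p ≠ 2)
    (u : ℤ_[p]) (t : ℤ_[p]) (ht : ‖t‖ = 1) (h : ‖t ^ 2 + u‖ < 1) :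
    ∃ y : ℤ_[p], y ^ 2 = -u := by
  have h2 : ‖(2 : ℤ_[p])‖ = 1 := by
    have := (PadicInt.norm_natCast_eq_one_iff (p := p) (n := 2)).2
      ((Nat.coprime_primes Fact.out Nat.prime_two).2 hp)
    exact_mod_cast this
  obtain ⟨y, hy, -⟩ := hensels_lemma (p := p) (R := ℤ_[p])
    (F := Polynomial.X ^ 2 + Polynomial.C u) (a := t) (by simpa [ht, h2, one_add_one_eq_two] using h)
  exact ⟨y, eq_neg_of_add_eq_zero_left (by simpa using hy)⟩

theorem norm_sq_add_mul_sq {p : ℕ} [Fact (Nat.Prime p)] (hp : p ≠ 2) (u : ℤ_[p]ˣ)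
    (hu : ∀ y : ℤ_[p], y ^ 2 ≠ -(u : ℤ_[p])) (a c : ℚ_[p]) :
    ‖a ^ 2 + ((u : ℤ_[p]) : ℚ_[p]) * c ^ 2‖ = max (‖a‖ ^ 2) (‖c‖ ^ 2) := by
  have hu1 : ‖((u : ℤ_[p]) : ℚ_[p])‖ = 1 := PadicInt.norm_units u
  have hmul : ‖((u : ℤ_[p]) : ℚ_[p]) * c ^ 2‖ = ‖c‖ ^ 2 := by
    rw [norm_mul, hu1, one_mul, norm_pow]
  by_cases hac : ‖a‖ = ‖c‖
  · rcases eq_or_ne c 0 with rfl | hc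
    · simp
    have ht : ‖a / c‖ = 1 := by rw [norm_div, hac, div_self (norm_ne_zero_iff.2 hc)]
    have hge : ¬ ‖(a / c) ^ 2 + ((u : ℤ_[p]) : ℚ_[p])‖ < 1 := fun h => by
      obtain ⟨y, hy⟩ := exists_sq_eq_neg_of_norm_lt_one hp (u : ℤ_[p]) ⟨a / c, ht.le⟩ ht h
      exact hu y hy
    have hle : ‖(a / c) ^ 2 + ((u : ℤ_[p]) : ℚ_[p])‖ ≤ 1 :=
      (Padic.nonarchimedean _ _).trans (by simp [-norm_div, ht, hu1])
    have hfac : a ^ 2 + ((u : ℤ_[p]) : ℚ_[p]) * c ^ 2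
        = ((a / c) ^ 2 + ((u : ℤ_[p]) : ℚ_[p])) * c ^ 2 := by field_simp
    rw [hfac, norm_mul, le_antisymm hle (not_lt.1 hge), one_mul, norm_pow, hac, max_self]
  · have hne : ‖a ^ 2‖ ≠ ‖((u : ℤ_[p]) : ℚ_[p]) * c ^ 2‖ := by
      rw [hmul, norm_pow]
      exact fun h => hac ((pow_left_inj₀ (norm_nonneg _) (norm_nonneg _) two_ne_zero).1 h)
    rw [Padic.add_eq_max_of_ne hne, hmul, norm_pow]

theorem exists_max_norm_sq {p : ℕ} [Fact (Nat.Prime p)] (a c : ℚ_[p]) :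
    ∃ e : ℚ_[p], max (‖a‖ ^ 2) (‖c‖ ^ 2) = ‖e‖ ^ 2 := by
  rcases max_choice (‖a‖ ^ 2) (‖c‖ ^ 2) with h | h
  exacts [⟨a, h⟩, ⟨c, h⟩]

theorem norm_le_one_of_sq_le {p : ℕ} [Fact (Nat.Prime p)] {b : ℚ_[p]}
    (h : ‖b‖ ^ 2 * (p : ℝ)⁻¹ ≤ 1) : ‖b‖ ≤ 1 := by
  have hp1 : (1 : ℝ) < p := by exact_mod_cast (Fact.out : Nat.Prime p).one_lt
  by_contra! hb
  have hb0 : b ≠ 0 := by rintro rfl; norm_num at hb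
  have hpb : (p : ℝ) ≤ ‖b‖ := by
    rw [Padic.norm_eq_zpow_neg_valuation hb0] at hb ⊢
    have h1 : 0 < -b.valuation := (one_lt_zpow_iff_right₀ hp1).1 hb
    simpa using zpow_le_zpow_right₀ hp1.le (show (1 : ℤ) ≤ -b.valuation by omega)
  rw [mul_inv_le_iff₀ (by linarith)] at h
  nlinarith

theorem norm_sq_ne_norm_sq_mul_inv {p : ℕ} [Fact (Nat.Prime p)] (e f : ℚ_[p]) (hf : f ≠ 0) :
    ‖e‖ ^ 2 ≠ ‖f‖ ^ 2 * (p : ℝ)⁻¹ := by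
  have hp1 : (1 : ℝ) < p := by exact_mod_cast (Fact.out : Nat.Prime p).one_lt
  have hp0 : (p : ℝ) ≠ 0 := by positivity
  intro h
  rcases eq_or_ne e 0 with rfl | he
  · have : ‖f‖ ^ 2 * (p : ℝ)⁻¹ ≠ 0 := by simp [hf, hp0]
    exact this (by rw [← h]; simp)
  rw [Padic.norm_eq_zpow_neg_valuation he, Padic.norm_eq_zpow_neg_valuation hf,
    ← zpow_natCast, ← zpow_natCast, ← zpow_mul, ← zpow_mul, ← zpow_sub_one₀ hp0] at h
  have := zpow_right_injective₀ (by linarith) hp1.ne' h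
  push_cast at this
  omega

theorem norm_le_one_of_quaternary_eq_one {p : ℕ} [Fact (Nat.Prime p)] (hp : p ≠ 2)
    (u v : ℤ_[p]ˣ) (hu : ∀ y : ℤ_[p], y ^ 2 ≠ -(u : ℤ_[p])) (a b c d : ℚ_[p])
    (h : a ^ 2 + ((u : ℤ_[p]) : ℚ_[p]) * c ^ 2
      - ((v : ℤ_[p]) : ℚ_[p]) * p * (b ^ 2 + ((u : ℤ_[p]) : ℚ_[p]) * d ^ 2) = 1) :
    (‖a‖ ≤ 1 ∧ ‖b‖ ≤ 1) ∧ ‖c‖ ≤ 1 ∧ ‖d‖ ≤ 1 := by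
  have hS := norm_sq_add_mul_sq hp u hu a c
  have hT : ‖-(((v : ℤ_[p]) : ℚ_[p]) * p * (b ^ 2 + ((u : ℤ_[p]) : ℚ_[p]) * d ^ 2))‖
      = max (‖b‖ ^ 2) (‖d‖ ^ 2) * (p : ℝ)⁻¹ := by
    have hv1 : ‖((v : ℤ_[p]) : ℚ_[p])‖ = 1 := PadicInt.norm_units v
    rw [norm_neg, norm_mul, norm_mul, hv1, Padic.norm_p, norm_sq_add_mul_sq hp u hu, one_mul,
      mul_comm]
  have hmax : max (max (‖a‖ ^ 2) (‖c‖ ^ 2)) (max (‖b‖ ^ 2) (‖d‖ ^ 2) * (p : ℝ)⁻¹) = 1 := by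
    obtain ⟨e, he⟩ := exists_max_norm_sq a c
    obtain ⟨f, hf⟩ := exists_max_norm_sq b d
    rw [sub_eq_add_neg] at h
    refine Eq.trans ?_ ((congrArg norm h).trans norm_one)
    rw [← hS, ← hT]
    rcases eq_or_ne f 0 with rfl | hf0
    · rw [hf] at hT
      have h0 := norm_eq_zero.1 (hT.trans (by simp))
      rw [h0]
      simp
    · refine (Padic.add_eq_max_of_ne ?_).symm
      rw [hS, hT, he, hf]
      exact norm_sq_ne_norm_sq_mul_inv e f hf0
  have hac := (le_max_left _ _).trans hmax.le
  have hbd := (le_max_right _ _).trans hmax.le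
  have hp0 : (0 : ℝ) ≤ (p : ℝ)⁻¹ := by positivity
  refine ⟨⟨?_, ?_⟩, ?_, ?_⟩
  · exact (sq_le_one_iff₀ (norm_nonneg _)).1 ((le_max_left _ _).trans hac)
  · exact norm_le_one_of_sq_le
      ((mul_le_mul_of_nonneg_right (le_max_left _ _) hp0).trans hbd)
  · exact (sq_le_one_iff₀ (norm_nonneg _)).1 ((le_max_right _ _).trans hac)
  · exact norm_le_one_of_sq_le
      ((mul_le_mul_of_nonneg_right (le_max_right _ _) hp0).trans hbd)

theorem algebraMap_mem_OH {p : ℕ} [Fact (Nat.Prime p)] {H : Type} [Field H]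
    [Algebra ℚ_[p] H] {a : ℚ_[p]} (ha : ‖a‖ ≤ 1) : algebraMap ℚ_[p] H a ∈ OH p H := by
  let : Algebra ℤ_[p] H := ((algebraMap ℚ_[p] H).comp PadicInt.Coe.ringHom).toAlgebra
  exact (isIntegral_algebraMap (R := ℤ_[p]) (A := H) (x := ⟨a, ha⟩))

theorem mem_OH_of_mul_self_mem {p : ℕ} [Fact (Nat.Prime p)] {H : Type} [Field H]
    [Algebra ℚ_[p] H] {y : H} (hy : y * y ∈ OH p H) : y ∈ OH p H := by
  let : Algebra ℤ_[p] H := ((algebraMap ℚ_[p] H).comp PadicInt.Coe.ringHom).toAlgebra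
  exact IsIntegral.of_pow (R := ℤ_[p]) two_pos (by rw [pow_two]; exact hy)

namespace IsRamifiedQuadratic

variable {p : ℕ} [Fact (Nat.Prime p)] {H : Type} [Field H] [Algebra ℚ_[p] H]
  {conj : H ≃+* H} {ϖ : H}

theorem unif_ne_zero (h : IsRamifiedQuadratic p H conj ϖ) : ϖ ≠ 0 := by
  have := charZero_of_injective_algebraMap (algebraMap ℚ_[p] H).injective
  obtain ⟨v, hv⟩ := h.unif_sq
  have hv0 : ((v : ℤ_[p]) : ℚ_[p]) ≠ 0 := by simp
  rintro rfl
  refine mul_ne_zero ((map_ne_zero (algebraMap ℚ_[p] H)).2 hv0)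
    (Nat.cast_ne_zero.2 (Fact.out : Nat.Prime p).ne_zero) (hv.symm.trans (mul_zero _))

theorem unif_mem_OH (h : IsRamifiedQuadratic p H conj ϖ) : ϖ ∈ OH p H := by
  obtain ⟨v, hv⟩ := h.unif_sq
  apply mem_OH_of_mul_self_mem
  rw [hv]
  exact mul_mem (algebraMap_mem_OH (v : ℤ_[p]).2) (natCast_mem _ p)

theorem exists_eq_add_mul_unif (h : IsRamifiedQuadratic p H conj ϖ) (x : H) :
    ∃ a b : ℚ_[p], x = algebraMap ℚ_[p] H a + algebraMap ℚ_[p] H b * ϖ := by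
  have := charZero_of_injective_algebraMap (algebraMap ℚ_[p] H).injective
  have hli : LinearIndependent ℚ_[p] ![(1 : H), ϖ] := by
    rw [LinearIndependent.pair_iff]
    intro s t hst
    simp only [Algebra.smul_def, mul_one] at hst
    have hst' := congrArg conj hst
    rw [map_add, map_mul, h.conj_fix, h.conj_fix, h.conj_unif, map_zero] at hst'
    have hs : algebraMap ℚ_[p] H s = 0 := by linear_combination (hst + hst') / 2
    have ht : algebraMap ℚ_[p] H t * ϖ = 0 := by linear_combination (hst - hst') / 2
    exact ⟨(map_eq_zero _).1 hs,
      (map_eq_zero _).1 ((mul_eq_zero.1 ht).resolve_right h.unif_ne_zero)⟩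
  have hx : x ∈ Submodule.span ℚ_[p] (Set.range ![(1 : H), ϖ]) := by
    rw [hli.span_eq_top_of_card_eq_finrank (by simp [h.dim_two])]
    trivial
  rw [Matrix.range_cons, Matrix.range_cons, Matrix.range_empty, Set.union_empty,
    Set.singleton_union, Submodule.mem_span_pair] at hx
  obtain ⟨a, b, rfl⟩ := hx
  exact ⟨a, b, by simp [Algebra.smul_def]⟩

end IsRamifiedQuadratic

/-- Let `u ∈ ℤ_p^×` with `-u ∉ Nm_{H/ℚ_p}(H^×)`. If `x, z ∈ H` satisfy
`x·x̄ + u·z·z̄ = 1`, then `x ∈ O_H` and `z ∈ O_H`. -/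
theorem statement_13 (p : ℕ) [Fact (Nat.Prime p)] (hp : p ≠ 2)
    (H : Type) [Field H] [Algebra ℚ_[p] H] (conj : H ≃+* H) (ϖ : H)
    (hram : IsRamifiedQuadratic p H conj ϖ)
    (u : ℤ_[p]ˣ)
    (hu : ∀ y : H, y ≠ 0 →
      y * conj y ≠ -(algebraMap ℚ_[p] H ((u : ℤ_[p]) : ℚ_[p])))
    (x z : H)
    (hxz : x * conj x + algebraMap ℚ_[p] H ((u : ℤ_[p]) : ℚ_[p]) * (z * conj z) = 1) :
    x ∈ OH p H ∧ z ∈ OH p H := by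
  obtain ⟨v, hv⟩ := hram.unif_sq
  obtain ⟨a, b, rfl⟩ := hram.exists_eq_add_mul_unif x
  obtain ⟨c, d, rfl⟩ := hram.exists_eq_add_mul_unif z
  have hsq : ∀ y : ℤ_[p], y ^ 2 ≠ -(u : ℤ_[p]) := fun y hy => by
    have hyQ : (y : ℚ_[p]) ^ 2 = -((u : ℤ_[p]) : ℚ_[p]) := by exact_mod_cast congrArg _ hy
    have hy0 : (y : ℚ_[p]) ≠ 0 := by
      intro h0
      simp [h0] at hyQ
    refine hu (algebraMap ℚ_[p] H y) ((map_ne_zero _).2 hy0) ?_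
    rw [hram.conj_fix, ← pow_two, ← map_pow, hyQ, map_neg]
  have key : a ^ 2 + ((u : ℤ_[p]) : ℚ_[p]) * c ^ 2
      - ((v : ℤ_[p]) : ℚ_[p]) * p * (b ^ 2 + ((u : ℤ_[p]) : ℚ_[p]) * d ^ 2) = 1 := by
    apply (algebraMap ℚ_[p] H).injective
    simp only [map_add, map_mul, hram.conj_fix, hram.conj_unif] at hxz
    simp only [map_add, map_sub, map_mul, map_pow, map_one, map_natCast]
    linear_combination hxz + ((algebraMap ℚ_[p] H b) ^ 2
      + algebraMap ℚ_[p] H ((u : ℤ_[p]) : ℚ_[p]) * (algebraMap ℚ_[p] H d) ^ 2) * hv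
  obtain ⟨⟨ha, hb⟩, hc, hd⟩ := norm_le_one_of_quaternary_eq_one hp u v hsq a b c d key
  exact ⟨add_mem (algebraMap_mem_OH ha) (mul_mem (algebraMap_mem_OH hb) hram.unif_mem_OH),
    add_mem (algebraMap_mem_OH hc) (mul_mem (algebraMap_mem_OH hd) hram.unif_mem_OH)⟩

end Ramified
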